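/- arXiv:2502.18115 — 4 statements merged into one kernel-verified Lean document; each statement's English description precedes it below -/
import Mathlib

section
/- Let $r \ge 1$, let $Q_1,\dots,Q_r \in \mathbb{C}$ be pairwise distinct, fix $a \in \{1,\dots,r\}$, let $n \ge 2$ be an integer, and let $f$ be complex-analytic on a neighborhood of $Q_a$. Define, for $y$ near $Q_a$ with $y \ne Q_a$, $H(y) = \frac{\prod_{q=1}^r (Q_q - y)}{\sum_{b=1}^r \prod_{q \ne b}(Q_q - y)}\cdot \frac{d}{dy}\Big(\frac{f(y)}{(Q_a - y)^{\,n-1}}\Big) \;-\; (n-1)\,\frac{f(y)}{(Q_a - y)^{\,n-1}}$. Then the function $y \mapsto (y - Q_a)^{\,n-2}\, H(y)$ extends analytically to $Q_a$; in other words, $H$ has a pole of order at most $n-2$ at $Q_a$, one less than the naively expected order $n-1$. -/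
/-- Splitting off one factor in the sum of products with one factor omitted. -/
theorem sum_prod_erase_eq_add_mul {ι R : Type*} [Fintype ι] [DecidableEq ι] [CommSemiring R]
    (g : ι → R) (a : ι) :
    ∑ b, ∏ q ∈ Finset.univ.erase b, g q =
      ∏ q ∈ Finset.univ.erase a, g q +
        g a * ∑ b ∈ Finset.univ.erase a, ∏ q ∈ (Finset.univ.erase b).erase a, g q := by
  rw [← Finset.add_sum_erase _ _ (Finset.mem_univ a), Finset.mul_sum]
  congr 1
  refine Finset.sum_congr rfl fun b hb => ?_
  rw [Finset.mul_prod_erase]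
  exact Finset.mem_erase.2 ⟨(Finset.ne_of_mem_erase hb).symm, Finset.mem_univ a⟩

theorem hasDerivAt_div_const_sub_pow {𝕜 : Type*} [NontriviallyNormedField 𝕜] {f : 𝕜 → 𝕜}
    {c y : 𝕜} (hf : DifferentiableAt 𝕜 f y) (hy : c - y ≠ 0) (m : ℕ) :
    HasDerivAt (fun z => f z / (c - z) ^ m)
      (deriv f y / (c - y) ^ m + m * f y / (c - y) ^ (m + 1)) y := by
  have h := hf.hasDerivAt.fun_div (((hasDerivAt_id y).const_sub c).fun_pow m) (pow_ne_zero m hy)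
  simp only [id] at h
  refine h.congr_deriv ?_
  rcases m with _ | m
  · simp
  · simp only [Nat.add_sub_cancel]
    field_simp
    ring

/-- **Lemma A.2.** Let `Q₁, …, Q_r ∈ ℂ` be pairwise distinct, `a` an index, `n ≥ 2`, and `f`
analytic near `Q_a`. The operator `d/dx - (n-1)` (with `x(y) = const - ∑_b log(Q_b - y)`)
applied to `f(y)/(Q_a - y)^{n-1}` has a pole of order at most `n-2` at `Q_a`: the function
`y ↦ (y - Q_a)^{n-2} H(y)` extends analytically to `Q_a`. -/
theorem pole_order_reduction (r : ℕ) (hr : 1 ≤ r) (Q : Fin r → ℂ)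
    (hQ : Function.Injective Q) (a : Fin r) (n : ℕ) (hn : 2 ≤ n)
    (f : ℂ → ℂ) (hf : AnalyticAt ℂ f (Q a))
    (H : ℂ → ℂ)
    (hH : ∀ y : ℂ, H y =
      (∏ q, (Q q - y)) / (∑ b, ∏ q ∈ Finset.univ.erase b, (Q q - y)) *
          deriv (fun z => f z / (Q a - z) ^ (n - 1)) y
        - ((n - 1 : ℕ) : ℂ) * (f y / (Q a - y) ^ (n - 1))) :
    ∃ G : ℂ → ℂ, AnalyticAt ℂ G (Q a) ∧
      ∀ᶠ y in nhdsWithin (Q a) {Q a}ᶜ, G y = (y - Q a) ^ (n - 2) * H y := by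
  obtain ⟨k, rfl⟩ := Nat.exists_eq_add_of_le' hn
  let P : ℂ → ℂ := fun y => ∏ q ∈ Finset.univ.erase a, (Q q - y)
  let S : ℂ → ℂ := fun y =>
    ∑ b ∈ Finset.univ.erase a, ∏ q ∈ (Finset.univ.erase b).erase a, (Q q - y)
  have hPan : AnalyticAt ℂ P (Q a) :=
    Finset.analyticAt_fun_prod _ fun q _ => analyticAt_const.sub analyticAt_id
  have hSan : AnalyticAt ℂ S (Q a) :=
    Finset.analyticAt_fun_sum _ fun b _ =>
      Finset.analyticAt_fun_prod _ fun q _ => analyticAt_const.sub analyticAt_id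
  have hDan : AnalyticAt ℂ (fun y => P y + (Q a - y) * S y) (Q a) :=
    hPan.add ((analyticAt_const.sub analyticAt_id).mul hSan)
  have hD : P (Q a) + (Q a - Q a) * S (Q a) ≠ 0 := by
    rw [sub_self, zero_mul, add_zero]
    exact Finset.prod_ne_zero_iff.2 fun q hq =>
      sub_ne_zero.2 (hQ.ne (Finset.ne_of_mem_erase hq))
  refine ⟨fun y => (-1) ^ k * ((P y * deriv f y - (k + 1 : ℂ) * f y * S y) /
    (P y + (Q a - y) * S y)), ?_, ?_⟩
  · exact analyticAt_const.mul
      (((hPan.mul hf.deriv).sub ((analyticAt_const.mul hf).mul hSan)).div hDan hD)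
  · filter_upwards [self_mem_nhdsWithin,
      nhdsWithin_le_nhds (hDan.continuousAt.eventually_ne hD),
      nhdsWithin_le_nhds hf.eventually_analyticAt] with y hy hDy hfy
    have hu : Q a - y ≠ 0 := sub_ne_zero.2 (Ne.symm hy)
    rw [hH, sum_prod_erase_eq_add_mul (fun q => Q q - y) a,
      ← Finset.mul_prod_erase _ _ (Finset.mem_univ a),
      (hasDerivAt_div_const_sub_pow hfy.differentiableAt hu _).deriv,
      show y - Q a = -1 * (Q a - y) by ring, mul_pow]
    change _ = (-1) ^ k * (Q a - y) ^ k * ((Q a - y) * P y / (P y + (Q a - y) * S y) *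
      (deriv f y / (Q a - y) ^ (k + 1) + ((k + 1 : ℕ) : ℂ) * f y / (Q a - y) ^ (k + 1 + 1)) -
      ((k + 1 : ℕ) : ℂ) * (f y / (Q a - y) ^ (k + 1)))
    push_cast
    generalize Q a - y = u at hu hDy ⊢
    obtain ⟨d, hd⟩ : ∃ d, d = P y + u * S y := ⟨_, rfl⟩
    rw [← hd] at hDy ⊢
    rw [eq_sub_of_add_eq hd.symm]
    field_simp
    ring
end

section
/- Let $r \ge 1$, let $Q_1,\dots,Q_r \in \mathbb{C}$ be pairwise distinct, fix $a \in \{1,\dots,r\}$, let $n \ge 1$ be an integer, and let $g$ be complex-analytic on a neighborhood of $Q_a$. Set $D_x = \frac{\prod_{q=1}^r(Q_q - y)}{\sum_{b=1}^r\prod_{q\ne b}(Q_q - y)}\,\frac{d}{dy}$ and define $P = (D_x + (n-1))(D_x + (n-2))\cdots(D_x + 1)\,g$ (for $n = 1$, $P = g$). Then $P$ is analytic at $Q_a$ and its Taylor expansion at $Q_a$ reads $P(y) = (n-1)!\; g(Q_a) + O\big((y - Q_a)^{n}\big)$; that is, the constant Taylor coefficient of $P$ at $Q_a$ equals $(n-1)!\,g(Q_a)$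 and the Taylor coefficients of orders $1$ through $n-1$ all vanish. -/
open Finset

/-- The derivative operator `d/dx` corresponding to `x(y) = const - ∑_b log(Q_b - y)`. -/
noncomputable def Dx (r : ℕ) (Q : Fin r → ℂ) : (ℂ → ℂ) → (ℂ → ℂ) :=
  fun h y => (∏ q, (Q q - y)) / (∑ b, ∏ q ∈ Finset.univ.erase b, (Q q - y)) * deriv h y

/-- `iterOp r Q g m = (d/dx + m)(d/dx + (m-1)) ⋯ (d/dx + 1) g`, with `iterOp r Q g 0 = g`. -/
noncomputable def iterOp (r : ℕ) (Q : Fin r → ℂ) (g : ℂ → ℂ) : ℕ → (ℂ → ℂ)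
  | 0 => g
  | m + 1 => fun y => Dx r Q (iterOp r Q g m) y + ((m + 1 : ℕ) : ℂ) * iterOp r Q g m y

/-- An analytic function vanishing at `z` is locally divisible by `y - z`. -/
theorem AnalyticAt.exists_eventually_eq_sub_mul {f : ℂ → ℂ} {z : ℂ} (hf : AnalyticAt ℂ f z)
    (h0 : f z = 0) :
    ∃ h : ℂ → ℂ, AnalyticAt ℂ h z ∧ ∀ᶠ y in nhds z, f y = (y - z) * h y := by
  have h1 : ((1 : ℕ) : ℕ∞) ≤ analyticOrderAt f z := by
    rw [natCast_le_analyticOrderAt_iff_iteratedDeriv_eq_zero hf]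
    intro i hi
    obtain rfl : i = 0 := by lia
    simpa using h0
  simpa using (natCast_le_analyticOrderAt hf).mp h1

/-- Near `Q a`, the coefficient of `Dx` is `-(y - Q a) * u y` with `u` analytic and
`u (Q a) = 1`. -/
theorem Dx_eq_neg_sub_mul (r : ℕ) (Q : Fin r → ℂ) (hQ : Function.Injective Q) (a : Fin r) :
    ∃ u : ℂ → ℂ, AnalyticAt ℂ u (Q a) ∧ u (Q a) = 1 ∧
      ∀ (f : ℂ → ℂ) (y : ℂ), Dx r Q f y = -(y - Q a) * u y * deriv f y := by
  have hne : ∏ q ∈ Finset.univ.erase a, (Q q - Q a) ≠ 0 :=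
    Finset.prod_ne_zero_iff.mpr fun q hq =>
      sub_ne_zero.mpr (hQ.ne (Finset.ne_of_mem_erase hq))
  have hsum : ∑ b, ∏ q ∈ Finset.univ.erase b, (Q q - Q a) =
      ∏ q ∈ Finset.univ.erase a, (Q q - Q a) := by
    refine Finset.sum_eq_single a (fun b _ hb => ?_) (by simp)
    exact Finset.prod_eq_zero (Finset.mem_erase.mpr ⟨hb.symm, Finset.mem_univ a⟩) (sub_self _)
  refine ⟨fun y => (∏ q ∈ Finset.univ.erase a, (Q q - y)) /
    (∑ b, ∏ q ∈ Finset.univ.erase b, (Q q - y)), ?_, ?_, fun f y => ?_⟩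
  · refine AnalyticAt.fun_div ?_ ?_ (by rwa [hsum])
    · exact Finset.analyticAt_fun_prod _ fun q _ => by fun_prop
    · exact Finset.analyticAt_fun_sum _ fun b _ =>
        Finset.analyticAt_fun_prod _ fun q _ => by fun_prop
  · simp only [hsum, div_self hne]
  · rw [Dx, ← Finset.mul_prod_erase Finset.univ _ (Finset.mem_univ a)]
    ring

/-- If `f = c + O((y - z) ^ n)` and `u z = 1`, then
`-(y - z) u f' + n f = n c + O((y - z) ^ (n + 1))`,
since `-(y - z) d/dy` has eigenvalue `-n` on `(y - z) ^ n`. -/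
theorem exists_eventually_eq_const_add_pow_succ_mul {f u h : ℂ → ℂ} {z c : ℂ} {n : ℕ}
    (hu : AnalyticAt ℂ u z) (hu1 : u z = 1) (hh : AnalyticAt ℂ h z)
    (hf : ∀ᶠ y in nhds z, f y = c + (y - z) ^ n * h y) :
    ∃ k : ℂ → ℂ, AnalyticAt ℂ k z ∧ ∀ᶠ y in nhds z,
      -(y - z) * u y * deriv f y + n * f y = n * c + (y - z) ^ (n + 1) * k y := by
  obtain ⟨v, hv, huv⟩ := AnalyticAt.exists_eventually_eq_sub_mul (f := fun y => 1 - u y)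
    (analyticAt_const.fun_sub hu) (by simp [hu1])
  have hh' := hh.deriv
  refine ⟨fun y => n * h y * v y - u y * deriv h y, by fun_prop, ?_⟩
  filter_upwards [hf.eventually_nhds, huv, hh.eventually_analyticAt] with y hfy huvy hhy
  have hd : deriv f y = n * (y - z) ^ (n - 1) * h y + (y - z) ^ n * deriv h y := by
    rw [Filter.EventuallyEq.deriv_eq hfy]
    have hp : HasDerivAt (fun y => (y - z) ^ n) (n * (y - z) ^ (n - 1)) y := by
      simpa using ((hasDerivAt_id y).sub_const z).fun_pow n
    exact ((hp.mul hhy.differentiableAt.hasDerivAt).const_add c).deriv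
  have hpow : (n : ℂ) * ((y - z) * (y - z) ^ (n - 1)) = n * (y - z) ^ n := by
    cases n with
    | zero => simp
    | succ m => simp [pow_succ']
  rw [hd, hfy.self_of_nhds]
  linear_combination (-(u y) * h y) * hpow + (n * (y - z) ^ n * h y) * huvy

theorem iterOp_eventually_eq (r : ℕ) (Q : Fin r → ℂ) (hQ : Function.Injective Q) (a : Fin r)
    {g : ℂ → ℂ} (hg : AnalyticAt ℂ g (Q a)) (m : ℕ) :
    ∃ h : ℂ → ℂ, AnalyticAt ℂ h (Q a) ∧ ∀ᶠ y in nhds (Q a),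
      iterOp r Q g m y = (m.factorial : ℂ) * g (Q a) + (y - Q a) ^ (m + 1) * h y := by
  induction m with
  | zero =>
    obtain ⟨h, hh, hgh⟩ := AnalyticAt.exists_eventually_eq_sub_mul (f := fun y => g y - g (Q a))
      (hg.fun_sub analyticAt_const) (sub_self _)
    refine ⟨h, hh, hgh.mono fun y hy => ?_⟩
    simp only [iterOp, Nat.factorial_zero, Nat.cast_one, zero_add, pow_one]
    linear_combination hy
  | succ m ih =>
    obtain ⟨h, hh, hfh⟩ := ih
    obtain ⟨u, hu, hu1, hDx⟩ := Dx_eq_neg_sub_mul r Q hQ a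
    obtain ⟨k, hk, hfk⟩ := exists_eventually_eq_const_add_pow_succ_mul hu hu1 hh hfh
    refine ⟨k, hk, hfk.mono fun y hy => ?_⟩
    simp only [iterOp]
    rw [hDx, hy, Nat.factorial_succ]
    push_cast
    ring

/-- Taylor-expansion claim inside the proof of Lemma A.3: for pairwise distinct `Q₁, …, Q_r`,
`n ≥ 1`, and `g` analytic near `Q_a`, the function
`P = (d/dx + (n-1)) ⋯ (d/dx + 1) g` is analytic at `Q_a`, with
`P(y) = (n-1)! g(Q_a) + O((y - Q_a)^n)`: its value at `Q_a` is `(n-1)! g(Q_a)` and its Taylor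
coefficients of orders `1` through `n-1` at `Q_a` all vanish. -/
theorem iterOp_taylor_expansion (r : ℕ) (hr : 1 ≤ r) (Q : Fin r → ℂ)
    (hQ : Function.Injective Q) (a : Fin r) (n : ℕ) (hn : 1 ≤ n)
    (g : ℂ → ℂ) (hg : AnalyticAt ℂ g (Q a)) :
    AnalyticAt ℂ (iterOp r Q g (n - 1)) (Q a) ∧
      iterOp r Q g (n - 1) (Q a) = (((n - 1).factorial : ℕ) : ℂ) * g (Q a) ∧
      ∀ k : ℕ, 1 ≤ k → k ≤ n - 1 → iteratedDeriv k (iterOp r Q g (n - 1)) (Q a) = 0 := by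
  obtain ⟨m, rfl⟩ := Nat.exists_eq_add_of_le' hn
  rw [Nat.add_sub_cancel]
  obtain ⟨h, hh, hev⟩ := iterOp_eventually_eq r Q hQ a hg m
  have hrem : AnalyticAt ℂ (fun y => (y - Q a) ^ (m + 1) * h y) (Q a) := by fun_prop
  refine ⟨(analyticAt_congr hev).mpr (by fun_prop), by simpa using hev.self_of_nhds,
    fun k hk1 hk2 => ?_⟩
  rw [(Filter.EventuallyEq.iteratedDeriv hev k).eq_of_nhds, iteratedDeriv_const_add hk1]
  refine (natCast_le_analyticOrderAt_iff_iteratedDeriv_eq_zero hrem).mp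
    ((natCast_le_analyticOrderAt hrem).mpr ⟨h, hh, ?_⟩) k (Nat.lt_succ_of_le hk2)
  exact Filter.Eventually.of_forall fun y => rfl
end

section
/- Let $r \ge 1$, let $Q_1,\dots,Q_r \in \mathbb{C}$ be pairwise distinct, fix $a \in \{1,\dots,r\}$, let $n \ge 1$ be an integer, and let $f,g$ be complex-analytic on a neighborhood of $Q_a$. Set $D_x = \frac{\prod_{q=1}^r(Q_q - y)}{\sum_{b=1}^r\prod_{q\ne b}(Q_q - y)}\,\frac{d}{dy}$ and $P = (D_x + (n-1))(D_x + (n-2))\cdots(D_x + 1)\,g$ (for $n=1$, $P = g$). Then for all sufficiently small $\varepsilon > 0$, $\frac{1}{2\pi i}\oint_{|y - Q_a| = \varepsilon} \frac{f(y)}{(y - Q_a)^{n}}\; P(y)\; dy \;=\; g(Q_a)\, f^{(n-1)}(Q_a)$, where $f^{(n-1)}$ is the $(n-1)$st complex derivative of $f$ and the contour is the positively oriented circle of radius $\varepsilon$ around $Q_a$. -/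
open Finset

open Filter Topology Metric

/-- The local parameter `w(y) = ∏ (Q_q - y)`, an eigenfunction of `d/dx` with eigenvalue `-1`,
has derivative `-∑_b ∏_{q ≠ b} (Q_q - y)`. -/
theorem hasDerivAt_prod_sub {r : ℕ} (Q : Fin r → ℂ) (y : ℂ) :
    HasDerivAt (fun z => ∏ q, (Q q - z)) (-∑ b, ∏ q ∈ univ.erase b, (Q q - y)) y := by
  simpa using HasDerivAt.fun_finsetProd (u := univ) (f := fun q z => Q q - z)
    fun q _ => (hasDerivAt_id y).const_sub (Q q)

theorem sum_prod_erase_sub_ne_zero {r : ℕ} {Q : Fin r → ℂ} (hQ : Function.Injective Q)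
    (a : Fin r) : ∑ b, ∏ q ∈ univ.erase b, (Q q - Q a) ≠ 0 := by
  rw [sum_eq_single a _ (by simp)]
  · exact prod_ne_zero_iff.2 fun q hq => sub_ne_zero.2 (hQ.ne (ne_of_mem_erase hq))
  · exact fun b _ hb => prod_eq_zero (mem_erase.2 ⟨hb.symm, mem_univ a⟩) (sub_self _)

/-- An analytic function is its value at `Q a` plus an analytic multiple of `∏ (Q_q - y)`. -/
theorem exists_eventually_eq_add_prod_mul {r : ℕ} {Q : Fin r → ℂ} (hQ : Function.Injective Q)
    (a : Fin r) {g : ℂ → ℂ} (hg : AnalyticAt ℂ g (Q a)) :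
    ∃ h : ℂ → ℂ, AnalyticAt ℂ h (Q a) ∧
      ∀ᶠ y in 𝓝 (Q a), g y = g (Q a) + (∏ q, (Q q - y)) * h y := by
  have hsub : AnalyticAt ℂ (fun y => g y - g (Q a)) (Q a) := hg.sub analyticAt_const
  obtain ⟨k, hk, hgk⟩ := (natCast_le_analyticOrderAt hsub (n := 1)).1 <| by
    rw [Nat.cast_one, Order.one_le_iff_ne_zero, hsub.analyticOrderAt_ne_zero, sub_self]
  have hu : AnalyticAt ℂ (fun y => ∏ q ∈ univ.erase a, (Q q - y)) (Q a) :=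
    univ.erase a |>.analyticAt_fun_prod fun q _ => by fun_prop
  have hu0 : ∏ q ∈ univ.erase a, (Q q - Q a) ≠ 0 :=
    prod_ne_zero_iff.2 fun q hq => sub_ne_zero.2 (hQ.ne (ne_of_mem_erase hq))
  refine ⟨fun y => -k y / ∏ q ∈ univ.erase a, (Q q - y), hk.neg.div hu hu0, ?_⟩
  filter_upwards [hgk, hu.continuousAt.eventually_ne hu0] with y hy hy0
  rw [← mul_prod_erase univ _ (mem_univ a)]
  rw [pow_one, smul_eq_mul] at hy
  field_simp
  linear_combination hy

/-- `(d/dx + m) ⋯ (d/dx + 1) g` agrees with the constant `m! g(Q_a)` to order `m + 1` at `Q_a`. -/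
theorem exists_eventually_iterOp_eq {r : ℕ} {Q : Fin r → ℂ} (hQ : Function.Injective Q)
    (a : Fin r) {g : ℂ → ℂ} (hg : AnalyticAt ℂ g (Q a)) (m : ℕ) :
    ∃ h : ℂ → ℂ, AnalyticAt ℂ h (Q a) ∧
      ∀ᶠ y in 𝓝 (Q a),
        iterOp r Q g m y = m.factorial * g (Q a) + (∏ q, (Q q - y)) ^ (m + 1) * h y := by
  induction m with
  | zero => simpa [iterOp] using exists_eventually_eq_add_prod_mul hQ a hg
  | succ m ih =>
    obtain ⟨h, hh, heq⟩ := ih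
    have hS : AnalyticAt ℂ (fun y => ∑ b, ∏ q ∈ univ.erase b, (Q q - y)) (Q a) :=
      univ.analyticAt_fun_sum fun b _ => (univ.erase b).analyticAt_fun_prod
        fun q _ => by fun_prop
    have hS0 := sum_prod_erase_sub_ne_zero hQ a
    refine ⟨fun y => deriv h y / ∑ b, ∏ q ∈ univ.erase b, (Q q - y), hh.deriv.div hS hS0, ?_⟩
    filter_upwards [heq.eventually_nhds, hh.eventually_analyticAt,
      hS.continuousAt.eventually_ne hS0] with y hy hhy hSy
    have hd := ((((hasDerivAt_prod_sub Q y).fun_pow (m + 1)).mul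
      hhy.differentiableAt.hasDerivAt).const_add (m.factorial * g (Q a))).congr_of_eventuallyEq hy
    simp only [iterOp, Dx]
    rw [hd.deriv, hy.self_of_nhds, Nat.factorial_succ]
    field_simp
    push_cast
    ring

/-- **Lemma A.3.** For pairwise distinct `Q₁, …, Q_r`, `n ≥ 1`, and `f, g` analytic near `Q_a`,
with `P = (d/dx + (n-1)) ⋯ (d/dx + 1) g`, the residue computation
`(2πi)⁻¹ ∮_{|y - Q_a| = ε} f(y)/(y - Q_a)^n · P(y) dy = g(Q_a) f^{(n-1)}(Q_a)` holds for all
sufficiently small `ε > 0`. -/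
theorem residue_computation (r : ℕ) (hr : 1 ≤ r) (Q : Fin r → ℂ)
    (hQ : Function.Injective Q) (a : Fin r) (n : ℕ) (hn : 1 ≤ n)
    (f g : ℂ → ℂ) (hf : AnalyticAt ℂ f (Q a)) (hg : AnalyticAt ℂ g (Q a)) :
    ∃ ε₀ : ℝ, 0 < ε₀ ∧ ∀ ε : ℝ, 0 < ε → ε < ε₀ →
      (2 * Real.pi * Complex.I)⁻¹ *
          (∮ y in C(Q a, ε), f y / (y - Q a) ^ n * iterOp r Q g (n - 1) y)
        = g (Q a) * iteratedDeriv (n - 1) f (Q a) := by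
  obtain ⟨m, rfl⟩ : ∃ m, n = m + 1 := ⟨n - 1, by omega⟩
  rw [Nat.add_sub_cancel]
  obtain ⟨h, hh, heq⟩ := exists_eventually_iterOp_eq hQ a hg m
  obtain ⟨ε₀, hε₀, hball⟩ := eventually_nhds_iff_ball.1
    (heq.and (hh.eventually_analyticAt.and hf.eventually_analyticAt))
  refine ⟨ε₀, hε₀, fun ε hε hlt => ?_⟩
  have hsub : closedBall (Q a) ε ⊆ ball (Q a) ε₀ := closedBall_subset_ball hlt
  have hfd : DifferentiableOn ℂ f (closedBall (Q a) ε) := fun y hy =>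
    (hball y (hsub hy)).2.2.differentiableAt.differentiableWithinAt
  have hhd : DifferentiableOn ℂ h (closedBall (Q a) ε) := fun y hy =>
    (hball y (hsub hy)).2.1.differentiableAt.differentiableWithinAt
  let R : ℂ → ℂ := fun y => (-∏ q ∈ univ.erase a, (Q q - y)) ^ (m + 1) * (f y * h y)
  have hR : DifferentiableOn ℂ R (closedBall (Q a) ε) := by
    have : Differentiable ℂ fun y => ∏ q ∈ univ.erase a, (Q q - y) :=
      Differentiable.fun_finsetProd fun q _ => by fun_prop
    exact (this.neg.pow _).differentiableOn.mul (hfd.mul hhd)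
  have hne : ∀ y ∈ sphere (Q a) ε, y - Q a ≠ 0 := fun y hy =>
    sub_ne_zero.2 (ne_of_mem_sphere hy hε.ne')
  have hcongr : Set.EqOn (fun y => f y / (y - Q a) ^ (m + 1) * iterOp r Q g m y)
      (fun y => (m.factorial * g (Q a)) • ((1 / (y - Q a) ^ (m + 1)) • f y) + R y)
      (sphere (Q a) ε) := by
    intro y hy
    have hy0 := hne y hy
    have hw : ∏ q, (Q q - y) = (y - Q a) * -∏ q ∈ univ.erase a, (Q q - y) := by
      rw [← mul_prod_erase univ _ (mem_univ a)]
      ring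
    simp only [(hball y (hsub (sphere_subset_closedBall hy))).1, hw, mul_pow, R, smul_eq_mul]
    field_simp
  have hint : CircleIntegrable
      (fun y => (m.factorial * g (Q a)) • ((1 / (y - Q a) ^ (m + 1)) • f y)) (Q a) ε := by
    refine ContinuousOn.circleIntegrable hε.le (ContinuousOn.fun_const_smul (ContinuousOn.fun_smul ?_
      (hfd.continuousOn.mono sphere_subset_closedBall)) _)
    exact continuousOn_const.div (by fun_prop) fun y hy => pow_ne_zero _ (hne y hy)
  have hRint : (∮ y in C(Q a, ε), R y) = 0 :=
    (hR.mono closure_ball_subset_closedBall).diffContOnCl.circleIntegral_eq_zero hε.le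
  rw [circleIntegral.integral_congr hε.le hcongr, circleIntegral.integral_add hint
    ((hR.continuousOn.mono sphere_subset_closedBall).circleIntegrable hε.le), hRint, add_zero,
    circleIntegral.integral_smul, hfd.circleIntegral_one_div_sub_center_pow_smul hε]
  have hfac : (m.factorial : ℂ) ≠ 0 := Nat.cast_ne_zero.2 m.factorial_ne_zero
  have hpi := Complex.two_pi_I_ne_zero
  simp only [smul_eq_mul]
  field_simp
end

section
/- Define $h : \mathbb{R} \to \mathbb{R}$ by $h(v) = \frac{1}{4\sinh^2(v/2)} - \frac{1}{v^2}$ for $v \ne 0$ and $h(0) = -\tfrac{1}{12}$. Then $h$ is continuous on $\mathbb{R}$, and for every real $c > 0$: $\frac{1}{2}\int_{-c}^{c}\int_{-c}^{c} h(s - t)\; ds\, dt \;=\; \log\frac{c}{\sinh c}$. -/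
/-- The entire function `sinh x / x`, extended by `1` at the origin. -/
noncomputable def sinhc : ℝ → ℝ := dslope Real.sinh 0

theorem mul_sinhc (x : ℝ) : x * sinhc x = Real.sinh x := by
  simpa [sinhc] using sub_smul_dslope Real.sinh 0 x

theorem sinhc_eq_div {x : ℝ} (hx : x ≠ 0) : sinhc x = Real.sinh x / x := by
  rw [← mul_sinhc, mul_div_cancel_left₀ _ hx]

@[simp] theorem sinhc_zero : sinhc 0 = 1 := by
  simp [sinhc]

theorem sinhc_pos (x : ℝ) : 0 < sinhc x := by
  rcases lt_trichotomy x 0 with hx | rfl | hx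
  · rw [sinhc_eq_div hx.ne]
    exact div_pos_of_neg_of_neg (Real.sinh_neg_iff.2 hx) hx
  · simp
  · rw [sinhc_eq_div hx.ne']
    exact div_pos (Real.sinh_pos_iff.2 hx) hx

theorem sinhc_neg (x : ℝ) : sinhc (-x) = sinhc x := by
  rcases eq_or_ne x 0 with rfl | hx
  · simp
  · rw [sinhc_eq_div hx, sinhc_eq_div (neg_ne_zero.2 hx), Real.sinh_neg, neg_div_neg_eq]

theorem analyticAt_sinhc (x : ℝ) : AnalyticAt ℝ sinhc x := by
  rcases eq_or_ne x 0 with rfl | hx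
  · obtain ⟨p, hp⟩ := Real.analyticAt_sinh (x := 0)
    exact ⟨_, hp.has_fpower_series_dslope_fslope⟩
  · refine (Real.analyticAt_sinh.div analyticAt_id hx).congr ?_
    filter_upwards [isOpen_ne.mem_nhds hx] with y hy
    exact (sinhc_eq_div hy).symm

theorem hasDerivAt_sinhc (x : ℝ) : HasDerivAt sinhc (deriv sinhc x) x :=
  (analyticAt_sinhc x).differentiableAt.hasDerivAt

theorem hasDerivAt_deriv_sinhc (x : ℝ) :
    HasDerivAt (deriv sinhc) (deriv (deriv sinhc) x) x :=
  (analyticAt_sinhc x).deriv.differentiableAt.hasDerivAt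

theorem sinhc_add_mul_deriv (x : ℝ) : sinhc x + x * deriv sinhc x = Real.cosh x := by
  have h₁ := (hasDerivAt_id x).mul (hasDerivAt_sinhc x)
  have h₂ : id * sinhc = Real.sinh := funext mul_sinhc
  rw [h₂] at h₁
  simpa using h₁.unique (Real.hasDerivAt_sinh x)

theorem two_mul_deriv_sinhc_add (x : ℝ) :
    2 * deriv sinhc x + x * deriv (deriv sinhc) x = Real.sinh x := by
  have h₁ := (hasDerivAt_sinhc x).add ((hasDerivAt_id x).mul (hasDerivAt_deriv_sinhc x))
  have h₂ : sinhc + id * deriv sinhc = Real.cosh := funext sinhc_add_mul_deriv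
  rw [h₂] at h₁
  have := h₁.unique (Real.hasDerivAt_cosh x)
  simp only [id_eq, one_mul] at this
  linarith

theorem deriv_sinhc_zero : deriv sinhc 0 = 0 := by
  simpa using two_mul_deriv_sinhc_add 0

theorem deriv_deriv_sinhc_zero : deriv (deriv sinhc) 0 = 1 / 3 := by
  have h₁ := ((hasDerivAt_deriv_sinhc 0).const_mul 2).add ((hasDerivAt_id 0).mul
    (analyticAt_sinhc 0).deriv.deriv.differentiableAt.hasDerivAt)
  have h₂ : (fun x => 2 * deriv sinhc x) + id * deriv (deriv sinhc) = Real.sinh :=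
    funext two_mul_deriv_sinhc_add
  rw [h₂] at h₁
  have := h₁.unique (Real.hasDerivAt_sinh 0)
  simp only [id_eq, one_mul, zero_mul, Real.cosh_zero] at this
  linarith

/-- The second derivative of `v ↦ -log (sinhc (v / 2))`. -/
noncomputable def regularizedKernel (v : ℝ) : ℝ :=
  -(deriv (deriv sinhc) (v / 2) * sinhc (v / 2) - deriv sinhc (v / 2) ^ 2)
    / (4 * sinhc (v / 2) ^ 2)

theorem regularizedKernel_eq (v : ℝ) : regularizedKernel v =
    if v = 0 then -(1 / 12) else 1 / (4 * Real.sinh (v / 2) ^ 2) - 1 / v ^ 2 := by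
  unfold regularizedKernel
  split_ifs with hv
  · subst hv
    norm_num [deriv_sinhc_zero, deriv_deriv_sinhc_zero]
  · obtain ⟨x, rfl⟩ : ∃ x, v = 2 * x := ⟨v / 2, by ring⟩
    have hx : x ≠ 0 := by simpa using hv
    rw [mul_div_cancel_left₀ x two_ne_zero, ← mul_sinhc x]
    have h₀ := (sinhc_pos x).ne'
    have h₁ := sinhc_add_mul_deriv x
    have h₂ := two_mul_deriv_sinhc_add x
    have h₃ := Real.cosh_sq x
    rw [← mul_sinhc x] at h₂ h₃
    rw [← h₁] at h₃
    field_simp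
    linear_combination (-4 * sinhc x * x) * h₂ + 4 * h₃

theorem continuous_regularizedKernel : Continuous regularizedKernel := by
  have h₀ : Continuous sinhc :=
    continuous_iff_continuousAt.2 fun x => (analyticAt_sinhc x).continuousAt
  have h₁ : Continuous (deriv sinhc) :=
    continuous_iff_continuousAt.2 fun x => (analyticAt_sinhc x).deriv.continuousAt
  have h₂ : Continuous (deriv (deriv sinhc)) :=
    continuous_iff_continuousAt.2 fun x => (analyticAt_sinhc x).deriv.deriv.continuousAt
  unfold regularizedKernel
  refine Continuous.div (by fun_prop) (by fun_prop) fun v => ?_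
  have := sinhc_pos (v / 2)
  positivity

theorem hasDerivAt_neg_log_sinhc_half (v : ℝ) :
    HasDerivAt (fun v => -Real.log (sinhc (v / 2)))
      (-(deriv sinhc (v / 2) / (2 * sinhc (v / 2)))) v := by
  have h : HasDerivAt (fun v => sinhc (v / 2)) (deriv sinhc (v / 2) * (1 / 2)) v :=
    (hasDerivAt_sinhc (v / 2)).comp v ((hasDerivAt_id v).div_const 2)
  refine (h.log (sinhc_pos _).ne').neg.congr_deriv ?_
  have := (sinhc_pos (v / 2)).ne'
  field_simp

theorem hasDerivAt_logDeriv_sinhc_half (v : ℝ) :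
    HasDerivAt (fun v => -(deriv sinhc (v / 2) / (2 * sinhc (v / 2))))
      (regularizedKernel v) v := by
  have hv := (hasDerivAt_id v).div_const 2
  have h₀ := (sinhc_pos (v / 2)).ne'
  have h := (((hasDerivAt_deriv_sinhc (v / 2)).comp v hv).div
    (((hasDerivAt_sinhc (v / 2)).comp v hv).const_mul 2) (by simpa using h₀)).neg
  refine h.congr_deriv ?_
  unfold regularizedKernel
  simp only [Function.comp_apply, id_eq]
  field_simp
  ring

/-- The integral of a continuous second derivative `h = H''` over the square `[a, b]²` along
differences of the coordinates. -/
theorem integral_integral_sub_of_hasDerivAt {H g h : ℝ → ℝ} (hH : ∀ v, HasDerivAt H (g v) v)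
    (hg : ∀ v, HasDerivAt g (h v) v) (hh : Continuous h) (a b : ℝ) :
    ∫ t in a..b, (∫ s in a..b, h (s - t)) = H (b - a) + H (a - b) - 2 * H 0 := by
  have hgc : Continuous g := continuous_iff_continuousAt.2 fun v => (hg v).continuousAt
  have h_inner (t : ℝ) : ∫ s in a..b, h (s - t) = g (b - t) - g (a - t) := by
    rw [intervalIntegral.integral_comp_sub_right h t]
    exact intervalIntegral.integral_eq_sub_of_hasDerivAt (fun v _ => hg v)
      (hh.intervalIntegrable _ _)
  have h_outer (p q : ℝ) : ∫ v in p..q, g v = H q - H p :=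
    intervalIntegral.integral_eq_sub_of_hasDerivAt (fun v _ => hH v)
      (hgc.intervalIntegrable _ _)
  simp_rw [h_inner]
  rw [intervalIntegral.integral_sub
      (Continuous.intervalIntegrable (by fun_prop) _ _)
      (Continuous.intervalIntegrable (by fun_prop) _ _),
    intervalIntegral.integral_comp_sub_left g, intervalIntegral.integral_comp_sub_left g,
    h_outer, h_outer, sub_self, sub_self]
  ring


/-- The regularized Bergman-kernel double integral of Example 2.6: with
`h(v) = 1/(4 sinh²(v/2)) - 1/v²` for `v ≠ 0` and `h(0) = -1/12`, the function `h` is continuous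
on `ℝ` and for every `c > 0`,
`(1/2) ∫_{-c}^{c} ∫_{-c}^{c} h(s - t) ds dt = log (c / sinh c)`. -/
theorem regularized_bergman_integral (h : ℝ → ℝ)
    (hh : ∀ v : ℝ, h v =
      if v = 0 then -(1 / 12) else 1 / (4 * Real.sinh (v / 2) ^ 2) - 1 / v ^ 2) :
    Continuous h ∧ ∀ c : ℝ, 0 < c →
      (1 / 2) * ∫ t in (-c)..c, (∫ s in (-c)..c, h (s - t))
        = Real.log (c / Real.sinh c) := by
  obtain rfl : h = regularizedKernel := funext fun v => (hh v).trans (regularizedKernel_eq v).symm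
  refine ⟨continuous_regularizedKernel, fun c hc => ?_⟩
  rw [integral_integral_sub_of_hasDerivAt hasDerivAt_neg_log_sinhc_half
      hasDerivAt_logDeriv_sinhc_half continuous_regularizedKernel,
    show (c - -c) / 2 = c by ring, show (-c - c) / 2 = -c by ring, sinhc_neg, zero_div,
    sinhc_zero, Real.log_one, ← inv_div (Real.sinh c) c, Real.log_inv,
    sinhc_eq_div hc.ne']
  ring
end
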